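/- Let h and g be holomorphic on the unit disk 𝔻, let M* ≥ 1 and 0 ≤ M₃ < 1/(1 + 2M*). Suppose F = h − g is univalent on 𝔻, F(𝔻) is an M*-linearly connected domain, and |g'(z)| ≤ M₃ |h'(z)| for all z ∈ 𝔻. Then for every θ ∈ [0, 2π), the harmonic mapping f_θ = h + e^{iθ}·conj(g) is univalent on 𝔻, f_θ(𝔻) is an (M*(1 + M₃)/(1 − M₃(1 + 2M*)))-linearly connected domain, and Λ_{f_θ}(z) ≤ ((1 + M₃)/(1 − M₃)) · λ_{f_θ}(z) for all z ∈ 𝔻 (i.e., f_θ is K-quasiconformal with K = (1 + M₃)/(1 − M₃)). -/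

import Mathlib

open Complex Metric Set ComplexConjugate

/-- A set `Ω ⊆ ℂ` is `M`-linearly connected if any two of its points can be joined by a
path in `Ω` of length at most `M` times the distance between them. -/
def LinearlyConnected (Ω : Set ℂ) (M : ℝ) : Prop :=
  ∀ z ∈ Ω, ∀ w ∈ Ω, ∃ γ : ℝ → ℂ,
    ContinuousOn γ (Set.Icc 0 1) ∧ γ 0 = z ∧ γ 1 = w ∧
    (∀ t ∈ Set.Icc (0 : ℝ) 1, γ t ∈ Ω) ∧
    eVariationOn γ (Set.Icc 0 1) ≤ ENNReal.ofReal (M * ‖z - w‖)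

open Filter Topology
open scoped NNReal ENNReal

theorem eVariationOn_Icc_add_Icc {α E : Type*} [LinearOrder α] [PseudoEMetricSpace E]
    (f : α → E) {a b c : α} (hab : a ≤ b) (hbc : b ≤ c) :
    eVariationOn f (Icc a b) + eVariationOn f (Icc b c) = eVariationOn f (Icc a c) := by
  simpa using eVariationOn.Icc_add_Icc f (s := univ) hab hbc (mem_univ b)

/-- A map which is `C`-Lipschitz near every point of a compact curve increases its length by a
factor of at most `C`. -/
theorem eVariationOn_comp_le_of_forall_exists_nhds_lipschitzOnWith {E F : Type*}
    [PseudoEMetricSpace E] [PseudoEMetricSpace F] {G : E → F} {C : ℝ≥0} {γ : ℝ → E} {a b : ℝ}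
    (hab : a ≤ b) (hγ : ContinuousOn γ (Icc a b))
    (hG : ∀ t ∈ Icc a b, ∃ V ∈ 𝓝 (γ t), LipschitzOnWith C G V) :
    eVariationOn (G ∘ γ) (Icc a b) ≤ C * eVariationOn γ (Icc a b) := by
  have hG' : ∀ t : Icc a b, ∃ V, IsOpen V ∧ γ t ∈ V ∧ LipschitzOnWith C G V := by
    intro t
    obtain ⟨V, hV, hL⟩ := hG t t.2
    obtain ⟨W, hWV, hW, hmem⟩ := mem_nhds_iff.1 hV
    exact ⟨W, hW, hmem, hL.mono hWV⟩
  choose V hVo hV hL using hG'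
  obtain ⟨t, ht0, ht, ⟨m, hm⟩, hc⟩ := exists_monotone_Icc_subset_open_cover_Icc hab
    (c := fun i => (fun s : Icc a b => γ s) ⁻¹' V i)
    (fun i => (hVo i).preimage hγ.domRestrict) (fun s _ => mem_iUnion.2 ⟨s, hV s⟩)
  have key : ∀ n, eVariationOn (G ∘ γ) (Icc a (t n)) ≤ C * eVariationOn γ (Icc a (t n)) := by
    intro n
    induction n with
    | zero =>
      rw [eVariationOn.subsingleton _ (by simp [ht0])]
      exact zero_le
    | succ n ih =>
      have hle : (t n : ℝ) ≤ t (n + 1) := ht n.le_succ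
      obtain ⟨i, hi⟩ := hc n
      rw [← eVariationOn_Icc_add_Icc (G ∘ γ) (t n).2.1 hle, ← eVariationOn_Icc_add_Icc γ (t n).2.1 hle,
        mul_add]
      refine add_le_add ih ((hL i).comp_eVariationOn_le fun s hs => ?_)
      exact hi (show (⟨s, (t n).2.1.trans hs.1, hs.2.trans (t (n + 1)).2.2⟩ : Icc a b) ∈
        Icc (t n) (t (n + 1)) from hs)
  have := key m
  rwa [hm m le_rfl] at this

section Univalent

variable {f : ℂ → ℂ} {U : Set ℂ} {z : ℂ}

/-- A univalent function is open at every point. -/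
theorem nhds_le_map_nhds_of_injOn (hU : IsOpen U) (hf : DifferentiableOn ℂ f U)
    (hinj : InjOn f U) (hz : z ∈ U) : 𝓝 (f z) ≤ map f (𝓝 z) := by
  refine (hf.analyticAt (hU.mem_nhds hz)).eventually_constant_or_nhds_le_map_nhds.resolve_left
    fun hc => ?_
  have : ∀ᶠ x in 𝓝[≠] z, False := by
    filter_upwards [nhdsWithin_le_nhds hc, nhdsWithin_le_nhds (hU.mem_nhds hz),
      self_mem_nhdsWithin] with x hx hxU hne
    exact hne (hinj hxU hz hx)
  exact this.exists.elim fun _ h => h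

theorem tendsto_invFunOn_nhds (hU : IsOpen U) (hf : DifferentiableOn ℂ f U)
    (hinj : InjOn f U) (hz : z ∈ U) : Tendsto (Function.invFunOn f U) (𝓝 (f z)) (𝓝 z) := by
  refine (map_mono (nhds_le_map_nhds_of_injOn hU hf hinj hz)).trans ?_
  rw [Filter.map_map]
  refine Tendsto.congr' ?_ tendsto_id
  filter_upwards [hU.mem_nhds hz] with x hx
  exact (hinj.leftInvOn_invFunOn hx).symm

theorem eventually_apply_invFunOn (hU : IsOpen U) (hf : DifferentiableOn ℂ f U)
    (hinj : InjOn f U) (hz : z ∈ U) : ∀ᶠ w in 𝓝 (f z), f (Function.invFunOn f U w) = w := by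
  have : f '' U ∈ 𝓝 (f z) :=
    nhds_le_map_nhds_of_injOn hU hf hinj hz (image_mem_map (hU.mem_nhds hz))
  filter_upwards [this] with w hw
  exact Function.invFunOn_eq hw

theorem hasDerivAt_invFunOn_of_deriv_ne_zero (hU : IsOpen U) (hf : DifferentiableOn ℂ f U)
    (hinj : InjOn f U) (hz : z ∈ U) (h0 : deriv f z ≠ 0) :
    HasDerivAt (Function.invFunOn f U) (deriv f z)⁻¹ (f z) := by
  have he : Function.invFunOn f U (f z) = z := hinj.leftInvOn_invFunOn hz
  have hc : ContinuousAt (Function.invFunOn f U) (f z) := by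
    simpa only [ContinuousAt, he] using tendsto_invFunOn_nhds hU hf hinj hz
  have hd : HasDerivAt f (deriv f z) (Function.invFunOn f U (f z)) := by
    rw [he]
    exact (hf.differentiableAt (hU.mem_nhds hz)).hasDerivAt
  exact hd.of_local_left_inverse hc h0 (eventually_apply_invFunOn hU hf hinj hz)

/-- The derivative of a univalent function does not vanish. -/
theorem deriv_ne_zero_of_injOn (hU : IsOpen U) (hf : DifferentiableOn ℂ f U)
    (hinj : InjOn f U) (hz : z ∈ U) : deriv f z ≠ 0 := by
  have hleft : LeftInvOn (Function.invFunOn f U) f U := hinj.leftInvOn_invFunOn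
  have hten := tendsto_invFunOn_nhds hU hf hinj hz
  have hright := eventually_apply_invFunOn hU hf hinj hz
  have hne : ∀ᶠ x in 𝓝[≠] z, deriv f x ≠ 0 := by
    refine (hf.analyticAt (hU.mem_nhds hz)).deriv.eventually_eq_zero_or_eventually_ne_zero
      |>.resolve_left fun h0 => ?_
    obtain ⟨r, hr, hball⟩ := Metric.eventually_nhds_iff_ball.1 (h0.and (hU.mem_nhds hz))
    have hlip : LipschitzOnWith 0 f (ball z r) :=
      Convex.lipschitzOnWith_of_nnnorm_deriv_le (𝕜 := ℂ)
        (fun x hx => hf.differentiableAt (hU.mem_nhds (hball x hx).2))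
        (fun x hx => by simp [(hball x hx).1]) (convex_ball z r)
    have hfalse : ∀ᶠ x in 𝓝[≠] z, False := by
      filter_upwards [nhdsWithin_le_nhds (ball_mem_nhds z hr), self_mem_nhdsWithin] with x hx hxz
      refine hxz (hinj (hball x hx).2 hz (dist_le_zero.1 ?_))
      simpa using hlip.dist_le_mul x hx z (mem_ball_self hr)
    exact hfalse.exists.elim fun _ h => h
  have hdiff : ∀ᶠ w in 𝓝[≠] f z, DifferentiableAt ℂ (Function.invFunOn f U) w := by
    have hten' : Tendsto (Function.invFunOn f U) (𝓝[≠] f z) (𝓝[≠] z) := by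
      refine tendsto_nhdsWithin_iff.2 ⟨hten.mono_left nhdsWithin_le_nhds, ?_⟩
      filter_upwards [nhdsWithin_le_nhds hright, self_mem_nhdsWithin] with w hw hwz he
      rw [mem_singleton_iff] at he
      exact hwz (by rw [mem_singleton_iff, ← hw, he])
    filter_upwards [hten'.eventually hne, nhdsWithin_le_nhds hright,
      nhdsWithin_le_nhds (hten.eventually (hU.mem_nhds hz))] with w h1 h2 h3
    have := hasDerivAt_invFunOn_of_deriv_ne_zero hU hf hinj h3 h1
    rw [h2] at this
    exact this.differentiableAt
  have hcont : ContinuousAt (Function.invFunOn f U) (f z) := by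
    simpa only [ContinuousAt, hleft hz] using hten
  have hinv := (analyticAt_of_differentiable_on_punctured_nhds_of_continuousAt hdiff
    hcont).differentiableAt.hasDerivAt
  have hd : HasDerivAt f (deriv f z) (Function.invFunOn f U (f z)) := by
    rw [hleft hz]
    exact (hf.differentiableAt (hU.mem_nhds hz)).hasDerivAt
  have hone := ((hd.comp (f z) hinv).congr_of_eventuallyEq
    (hright.mono fun w hw => hw.symm : id =ᶠ[𝓝 (f z)] f ∘ Function.invFunOn f U)).unique
      (hasDerivAt_id (f z))
  exact left_ne_zero_of_mul_eq_one hone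

/-- If `|g'| ≤ k |f'|` with `f` univalent, then `g ∘ f⁻¹` is `k`-Lipschitz near every point of the
image of `f`. -/
theorem exists_nhds_lipschitzOnWith_comp_invFunOn {g : ℂ → ℂ} {k : ℝ≥0} (hU : IsOpen U)
    (hf : DifferentiableOn ℂ f U) (hinj : InjOn f U) (hg : DifferentiableOn ℂ g U)
    (hk : ∀ x ∈ U, ‖deriv g x‖ ≤ k * ‖deriv f x‖) {w : ℂ} (hw : w ∈ f '' U) :
    ∃ V ∈ 𝓝 w, LipschitzOnWith k (g ∘ Function.invFunOn f U) V := by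
  obtain ⟨z, hz, rfl⟩ := hw
  have himage : f '' U ∈ 𝓝 (f z) :=
    nhds_le_map_nhds_of_injOn hU hf hinj hz (image_mem_map (hU.mem_nhds hz))
  obtain ⟨r, hr, hball⟩ := Metric.mem_nhds_iff.1 himage
  have hder : ∀ x ∈ U, HasDerivAt (g ∘ Function.invFunOn f U)
      (deriv g x * (deriv f x)⁻¹) (f x) := fun x hx => by
    have hd : HasDerivAt g (deriv g x) (Function.invFunOn f U (f x)) := by
      rw [hinj.leftInvOn_invFunOn hx]
      exact (hg.differentiableAt (hU.mem_nhds hx)).hasDerivAt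
    exact hd.comp (f x) (hasDerivAt_invFunOn_of_deriv_ne_zero hU hf hinj hx
      (deriv_ne_zero_of_injOn hU hf hinj hx))
  refine ⟨ball (f z) r, ball_mem_nhds _ hr, Convex.lipschitzOnWith_of_nnnorm_deriv_le (𝕜 := ℂ)
    (fun y hy => ?_) (fun y hy => ?_) (convex_ball _ _)⟩
  · obtain ⟨x, hx, rfl⟩ := hball hy
    exact (hder x hx).differentiableAt
  · obtain ⟨x, hx, rfl⟩ := hball hy
    rw [(hder x hx).deriv, ← NNReal.coe_le_coe, coe_nnnorm, norm_mul, norm_inv, ← div_eq_mul_inv,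
      div_le_iff₀ (norm_pos_iff.2 (deriv_ne_zero_of_injOn hU hf hinj hx))]
    exact hk x hx

end Univalent

/-- Length of the image of a curve of length at most `d`, for real-valued bounds. -/
theorem eVariationOn_comp_le_ofReal {E F : Type*}
    [PseudoEMetricSpace E] [PseudoEMetricSpace F] {G : E → F} {C : ℝ≥0} {γ : ℝ → E} {a b d : ℝ}
    (hab : a ≤ b) (hγ : ContinuousOn γ (Icc a b))
    (hG : ∀ t ∈ Icc a b, ∃ V ∈ 𝓝 (γ t), LipschitzOnWith C G V)
    (hd : eVariationOn γ (Icc a b) ≤ ENNReal.ofReal d) :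
    eVariationOn (G ∘ γ) (Icc a b) ≤ ENNReal.ofReal (C * d) := by
  rw [ENNReal.ofReal_mul C.coe_nonneg, ENNReal.ofReal_coe_nnreal]
  exact (eVariationOn_comp_le_of_forall_exists_nhds_lipschitzOnWith hab hγ hG).trans
    (by gcongr)

/-- A locally `C`-Lipschitz map on an `M`-linearly connected set is `C * M`-Lipschitz. -/
theorem LinearlyConnected.norm_sub_le {Ω : Set ℂ} {M : ℝ} (hΩ : LinearlyConnected Ω M)
    (hM : 0 ≤ M) {G : ℂ → ℂ} {C : ℝ≥0} (hG : ∀ w ∈ Ω, ∃ V ∈ 𝓝 w, LipschitzOnWith C G V)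
    {z w : ℂ} (hz : z ∈ Ω) (hw : w ∈ Ω) : ‖G z - G w‖ ≤ C * (M * ‖z - w‖) := by
  obtain ⟨γ, hγ, rfl, rfl, hmem, hlen⟩ := hΩ z hz w hw
  have hle := (eVariationOn.edist_le (G ∘ γ) (left_mem_Icc.2 zero_le_one)
    (right_mem_Icc.2 zero_le_one)).trans
      (eVariationOn_comp_le_ofReal zero_le_one hγ (fun t ht => hG _ (hmem t ht)) hlen)
  rw [edist_dist, ENNReal.ofReal_le_ofReal_iff (by positivity), dist_eq_norm] at hle
  exact hle

/-- If `Φ` is locally `C`-Lipschitz on an `M`-linearly connected set and expands distances by a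
factor of at least `c > 0`, then its image is `C * M / c`-linearly connected. -/
theorem LinearlyConnected.image {Ω : Set ℂ} {M : ℝ} (hΩ : LinearlyConnected Ω M)
    (hM : 0 ≤ M) {Φ : ℂ → ℂ} {C : ℝ≥0} {c : ℝ} (hc : 0 < c)
    (hΦ : ∀ w ∈ Ω, ∃ V ∈ 𝓝 w, LipschitzOnWith C Φ V)
    (hexp : ∀ z ∈ Ω, ∀ w ∈ Ω, c * ‖z - w‖ ≤ ‖Φ z - Φ w‖) :
    LinearlyConnected (Φ '' Ω) (C * M / c) := by
  rintro _ ⟨z, hz, rfl⟩ _ ⟨w, hw, rfl⟩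
  obtain ⟨γ, hγ, h0, h1, hmem, hlen⟩ := hΩ z hz w hw
  refine ⟨Φ ∘ γ, fun t ht => ?_, by simp [h0], by simp [h1],
    fun t ht => mem_image_of_mem Φ (hmem t ht), ?_⟩
  · obtain ⟨V, hV, hL⟩ := hΦ _ (hmem t ht)
    exact (hL.continuousOn.continuousAt hV).comp_continuousWithinAt (hγ t ht)
  · refine (eVariationOn_comp_le_ofReal zero_le_one hγ (fun t ht => hΦ _ (hmem t ht)) hlen).trans
      (ENNReal.ofReal_le_ofReal ?_)
    have := mul_le_mul_of_nonneg_left (hexp z hz w hw) (by positivity : 0 ≤ C * M / c)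
    refine le_trans (le_of_eq ?_) this
    field_simp

/-- If `F = h - g` is univalent with `M*`-linearly connected image and
`|g'| ≤ M₃|h'|` with `0 ≤ M₃ < 1/(1+2M*)`, then for every `θ ∈ [0,2π)` the harmonic
mapping `f_θ = h + e^{iθ}·conj g` is univalent, its image is
`(M*(1+M₃)/(1-M₃(1+2M*)))`-linearly connected, and
`Λ_{f_θ} ≤ ((1+M₃)/(1-M₃))·λ_{f_θ}` (i.e. `f_θ` is `K`-quasiconformal). -/
theorem shear_quasiconformal_linearly_connected
    (h g : ℂ → ℂ) (Mstar M₃ : ℝ) (hMstar : 1 ≤ Mstar)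
    (hM₃0 : 0 ≤ M₃) (hM₃ : M₃ < 1 / (1 + 2 * Mstar))
    (hh : DifferentiableOn ℂ h (ball (0 : ℂ) 1))
    (hg : DifferentiableOn ℂ g (ball (0 : ℂ) 1))
    (hFinj : Set.InjOn (fun z => h z - g z) (ball (0 : ℂ) 1))
    (hFlin : LinearlyConnected ((fun z => h z - g z) '' ball (0 : ℂ) 1) Mstar)
    (hω : ∀ z ∈ ball (0 : ℂ) 1, ‖deriv g z‖ ≤ M₃ * ‖deriv h z‖) :
    ∀ θ ∈ Ico (0 : ℝ) (2 * Real.pi),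
      Set.InjOn (fun z => h z + Complex.exp (θ * Complex.I) * conj (g z))
        (ball (0 : ℂ) 1) ∧
      LinearlyConnected
        ((fun z => h z + Complex.exp (θ * Complex.I) * conj (g z)) '' ball (0 : ℂ) 1)
        (Mstar * (1 + M₃) / (1 - M₃ * (1 + 2 * Mstar))) ∧
      ∀ z ∈ ball (0 : ℂ) 1,
        ‖deriv h z‖ + ‖deriv g z‖ ≤
          (1 + M₃) / (1 - M₃) * |‖deriv h z‖ - ‖deriv g z‖| := by
  intro θ _
  set c : ℂ := Complex.exp (θ * Complex.I)
  have hc : ‖c‖ = 1 := Complex.norm_exp_ofReal_mul_I θ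
  set U : Set ℂ := ball (0 : ℂ) 1
  set F : ℂ → ℂ := fun z => h z - g z with hF_def
  have hU : IsOpen U := isOpen_ball
  have hF : DifferentiableOn ℂ F U := hh.sub hg
  have hpos : 0 < 1 - M₃ * (1 + 2 * Mstar) := by
    have := (lt_div_iff₀ (by linarith)).1 hM₃
    linarith
  have hM₃1 : 0 < 1 - M₃ := by nlinarith
  obtain ⟨k, hk⟩ : ∃ k : ℝ≥0, (k : ℝ) = M₃ / (1 - M₃) := ⟨⟨_, by positivity⟩, rfl⟩
  have hderiv : ∀ z ∈ U, ‖deriv g z‖ ≤ k * ‖deriv F z‖ := by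
    intro z hz
    have hFz : deriv F z = deriv h z - deriv g z :=
      deriv_sub (hh.differentiableAt (hU.mem_nhds hz)) (hg.differentiableAt (hU.mem_nhds hz))
    have htri := norm_sub_norm_le (deriv h z) (deriv g z)
    rw [hk, hFz, div_mul_eq_mul_div, le_div_iff₀ hM₃1]
    nlinarith [hω z hz, mul_le_mul_of_nonneg_left htri hM₃0]
  set G : ℂ → ℂ := g ∘ Function.invFunOn F U
  have hG : ∀ w ∈ F '' U, ∃ V ∈ 𝓝 w, LipschitzOnWith k G V := fun w hw =>
    exists_nhds_lipschitzOnWith_comp_invFunOn hU hF hFinj hg hderiv hw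
  set Φ : ℂ → ℂ := fun w => w + (G w + c * conj (G w)) with hΦ_def
  have hshear : ∀ a b : ℂ, ‖(a + c * conj a) - (b + c * conj b)‖ ≤ 2 * ‖a - b‖ := by
    intro a b
    calc ‖(a + c * conj a) - (b + c * conj b)‖ = ‖(a - b) + c * conj (a - b)‖ := by
          rw [map_sub]; ring_nf
      _ ≤ ‖a - b‖ + ‖c * conj (a - b)‖ := norm_add_le _ _
      _ = 2 * ‖a - b‖ := by rw [norm_mul, hc, RCLike.norm_conj]; ring
  have hΦ : ∀ w ∈ F '' U, ∃ V ∈ 𝓝 w, LipschitzOnWith (1 + 2 * k) Φ V := by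
    intro w hw
    obtain ⟨V, hV, hL⟩ := hG w hw
    refine ⟨V, hV, LipschitzWith.id.lipschitzOnWith.add (LipschitzOnWith.of_dist_le_mul fun x hx y hy => ?_)⟩
    have := hL.dist_le_mul x hx y hy
    rw [dist_eq_norm] at this ⊢
    refine (hshear _ _).trans ?_
    push_cast
    linarith
  have hexp : ∀ z ∈ F '' U, ∀ w ∈ F '' U,
      (1 - M₃ * (1 + 2 * Mstar)) / (1 - M₃) * ‖z - w‖ ≤ ‖Φ z - Φ w‖ := by
    intro z hz w hw
    have hbound := hFlin.norm_sub_le (by linarith) hG hz hw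
    have hsplit : ‖z - w‖ ≤ ‖Φ z - Φ w‖ +
        ‖(G z + c * conj (G z)) - (G w + c * conj (G w))‖ := by
      refine le_trans (le_of_eq ?_) (norm_sub_le _ _)
      simp only [hΦ_def]
      ring_nf
    have hfac : (1 - M₃ * (1 + 2 * Mstar)) / (1 - M₃) = 1 - 2 * (k * Mstar) := by
      rw [hk]
      field_simp
      ring
    rw [hfac]
    linarith [hshear (G z) (G w)]
  have hΦF : ∀ z ∈ U, Φ (F z) = h z + c * conj (g z) := by
    intro z hz
    have hGF : G (F z) = g z := congrArg g (hFinj.leftInvOn_invFunOn hz)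
    change F z + (G (F z) + c * conj (G (F z))) = _
    rw [hGF]
    simp only [hF_def]
    ring
  refine ⟨fun z hz w hw hzw => hFinj hz hw ?_, ?_, fun z hz => ?_⟩
  · have := hexp _ (mem_image_of_mem F hz) _ (mem_image_of_mem F hw)
    rw [hΦF z hz, hΦF w hw, sub_eq_zero.2 hzw, norm_zero] at this
    exact sub_eq_zero.1 (norm_le_zero_iff.1 (nonpos_of_mul_nonpos_right this (by positivity)))
  · have := hFlin.image (by linarith) (by positivity) hΦ hexp
    rw [image_image, image_congr hΦF] at this
    convert this using 1
    push_cast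
    rw [hk]
    field_simp
    ring
  · have hdz := hω z hz
    have hle := le_abs_self (‖deriv h z‖ - ‖deriv g z‖)
    rw [div_mul_eq_mul_div, le_div_iff₀ hM₃1]
    nlinarith
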